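/- Let λ, C ∈ ℂ and let u, v, U, V, S : ℝ² → ℂ be smooth functions such that S is nowhere zero, S² = C − UV, U_x = λU − 2uS and V_x = −λV − 2vS on ℝ². Then S_x = uV + vU; and if in addition U, V satisfy the linearized NLS system iU_t = U_xx + 4uvU + 2u²V, iV_t = −V_xx − 2v²U − 4uvV, then iU_t = (2uv + λ²)U − 2(u_x + λu)S and iV_t = −(2uv + λ²)V + 2(v_x − λv)S hold on ℝ². (The generalized invariant manifold U_x = λU − 2uS, V_x = −λV − 2vS converts the linearized NLS system into the t-part of the nonlinear Lax pair.) -/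

import Mathlib

open Complex

/-- Partial derivative with respect to the first variable `x`. -/
noncomputable def dX (f : ℝ → ℝ → ℂ) : ℝ → ℝ → ℂ := fun x t => deriv (fun y => f y t) x

/-- Partial derivative with respect to the second variable `t`. -/
noncomputable def dT (f : ℝ → ℝ → ℂ) : ℝ → ℝ → ℂ := fun x t => deriv (fun s => f x s) t

/-- `f` is a smooth function of `(x,t) ∈ ℝ²`. -/
def Smooth2 (f : ℝ → ℝ → ℂ) : Prop := ContDiff ℝ (⊤ : ℕ∞) (fun p : ℝ × ℝ => f p.1 p.2)

theorem Smooth2.hasDerivAt_dX {f : ℝ → ℝ → ℂ} (hf : Smooth2 f) (x t : ℝ) :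
    HasDerivAt (fun y => f y t) (dX f x t) x := by
  have h : ContDiff ℝ (⊤ : ℕ∞) (fun y : ℝ => f y t) :=
    ContDiff.comp (g := fun p : ℝ × ℝ => f p.1 p.2) hf (contDiff_id.prodMk contDiff_const)
  exact (h.differentiable (by simp) x).hasDerivAt

/-- On the generalized invariant manifold `U_x = λU − 2uS`, `V_x = −λV − 2vS`,
`S² = C − UV`, one has `S_x = uV + vU`; and the linearized NLS system reduces to
the `t`-part of the nonlinear Lax pair. -/
theorem gim_converts_linearized_NLS
    (lam C : ℂ) (u v U V S : ℝ → ℝ → ℂ)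
    (hu : Smooth2 u) (hv : Smooth2 v) (hU : Smooth2 U) (hV : Smooth2 V) (hS : Smooth2 S)
    (hSne : ∀ x t, S x t ≠ 0)
    (hS2 : ∀ x t, (S x t) ^ 2 = C - U x t * V x t)
    (hUx : ∀ x t, dX U x t = lam * U x t - 2 * u x t * S x t)
    (hVx : ∀ x t, dX V x t = -lam * V x t - 2 * v x t * S x t) :
    (∀ x t, dX S x t = u x t * V x t + v x t * U x t) ∧
    ((∀ x t, I * dT U x t = dX (dX U) x t + 4 * u x t * v x t * U x t + 2 * (u x t) ^ 2 * V x t) →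
     (∀ x t, I * dT V x t = -(dX (dX V) x t) - 2 * (v x t) ^ 2 * U x t - 4 * u x t * v x t * V x t) →
     ((∀ x t, I * dT U x t =
        (2 * u x t * v x t + lam ^ 2) * U x t - 2 * (dX u x t + lam * u x t) * S x t) ∧
      (∀ x t, I * dT V x t =
        -(2 * u x t * v x t + lam ^ 2) * V x t + 2 * (dX v x t - lam * v x t) * S x t))) := by
  have hSx : ∀ x t, dX S x t = u x t * V x t + v x t * U x t := by
    intro x t
    have h₁ := (hS.hasDerivAt_dX x t).pow 2
    have h₂ := ((hU.hasDerivAt_dX x t).mul (hV.hasDerivAt_dX x t)).const_sub C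
    have heq : (fun y => S y t) ^ 2 = fun y => C - ((fun y => U y t) * fun y => V y t) y :=
      funext fun y => hS2 y t
    rw [heq] at h₁
    have h := h₁.unique h₂
    rw [hUx, hVx] at h
    apply mul_left_cancel₀ (mul_ne_zero two_ne_zero (hSne x t))
    norm_num at h
    linear_combination h
  have hUxx : ∀ x t, dX (dX U) x t =
      lam * dX U x t - 2 * (dX u x t * S x t + u x t * dX S x t) := by
    intro x t
    have h := ((hU.hasDerivAt_dX x t).const_mul lam).sub
      (((hu.hasDerivAt_dX x t).mul (hS.hasDerivAt_dX x t)).const_mul 2)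
    refine HasDerivAt.deriv (h.congr_of_eventuallyEq (.of_forall fun y => ?_))
    simp [hUx, mul_assoc]
  have hVxx : ∀ x t, dX (dX V) x t =
      -lam * dX V x t - 2 * (dX v x t * S x t + v x t * dX S x t) := by
    intro x t
    have h := ((hV.hasDerivAt_dX x t).const_mul (-lam)).sub
      (((hv.hasDerivAt_dX x t).mul (hS.hasDerivAt_dX x t)).const_mul 2)
    refine HasDerivAt.deriv (h.congr_of_eventuallyEq (.of_forall fun y => ?_))
    simp [hVx, mul_assoc]
  refine ⟨hSx, fun hUt hVt => ⟨fun x t => ?_, fun x t => ?_⟩⟩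
  · rw [hUt, hUxx, hUx, hSx]
    ring
  · rw [hVt, hVxx, hVx, hSx]
    ring
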